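/- Let n, k, m ≥ 1. For j = 1, …, m and t = 1, …, n let K_{tj} be k×k real symmetric positive semidefinite matrices whose diagonal entries are all at most K̄ for some K̄ ≥ 0, let γ_{tj} ∈ ℝ^k be the vector of square roots of the diagonal entries of K_{tj}, and let ψ_j ≥ 0 with ψ̄ = max_j ψ_j. Define the gap vector v ∈ ℝ^m by v_j = ψ_j·√(Σ_{t=1}^n x_tᵀ K_{tj} x_t) − (ψ_j/√n)·Σ_{t=1}^n γ_{tj}ᵀ x_t. Then for any x_1, …, x_n ∈ {0,1}^k with 1ᵀx_t ≤ 1 for every t, the Euclidean norm satisfies ‖v‖₂ ≤ √m · ψ̄ · √(K̄) · √n. -/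

import Mathlib

open Matrix BigOperators

/-- A binary vector whose entries sum to at most one is zero or a standard basis vector. -/
lemma eq_zero_or_eq_single_of_sum_le_one {ι : Type*} [Fintype ι] [DecidableEq ι] {x : ι → ℝ}
    (hx : ∀ l, x l = 0 ∨ x l = 1) (hsum : ∑ l, x l ≤ 1) :
    x = 0 ∨ ∃ l, x = Pi.single l 1 := by
  have hnonneg (l : ι) : 0 ≤ x l := by rcases hx l with h | h <;> simp [h]
  by_cases hone : ∃ l, x l = 1
  · obtain ⟨l, hl⟩ := hone
    refine .inr ⟨l, funext fun i => ?_⟩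
    by_cases hil : i = l
    · simp [hil, hl]
    · have hpair : x i + x l ≤ ∑ l, x l := by
        rw [← Finset.sum_pair hil]
        exact Finset.sum_le_sum_of_subset_of_nonneg (Finset.subset_univ _) fun a _ _ => hnonneg a
      rw [Pi.single_eq_of_ne hil]
      linarith [hnonneg i]
  · push Not at hone
    exact .inl (funext fun l => (hx l).resolve_right (hone l))

/-- On a binary vector with at most one nonzero entry, the quadratic form of a matrix and the
linear form of the square roots of its diagonal are controlled by a bound on the diagonal. -/
lemma quadratic_and_sqrt_diag_bounds {ι : Type*} [Fintype ι] {K : Matrix ι ι ℝ}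
    {c : ℝ} (hc : 0 ≤ c) (hdiag : ∀ l, K l l ≤ c) {x : ι → ℝ}
    (hx : ∀ l, x l = 0 ∨ x l = 1) (hsum : ∑ l, x l ≤ 1) :
    x ⬝ᵥ K.mulVec x ≤ c ∧ 0 ≤ (fun l => √(K l l)) ⬝ᵥ x ∧ (fun l => √(K l l)) ⬝ᵥ x ≤ √c := by
  classical
  rcases eq_zero_or_eq_single_of_sum_le_one hx hsum with rfl | ⟨l, rfl⟩
  · simp [hc]
  · simpa using ⟨hdiag l, Real.sqrt_le_sqrt (hdiag l)⟩

theorem stmt_9 (n k m : ℕ) (hn : 1 ≤ n) (hk : 1 ≤ k) (hm : 1 ≤ m)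
    (K : Fin n → Fin m → Matrix (Fin k) (Fin k) ℝ)
    (hK : ∀ t j, (K t j).PosSemidef)
    (Kbar : ℝ) (hKbar : 0 ≤ Kbar) (hKdiag : ∀ t j l, K t j l l ≤ Kbar)
    (γ : Fin n → Fin m → Fin k → ℝ)
    (hγ : ∀ t j l, γ t j l = Real.sqrt (K t j l l))
    (ψ : Fin m → ℝ) (hψ : ∀ j, 0 ≤ ψ j)
    (ψbar : ℝ) (hψbar : IsGreatest (Set.range ψ) ψbar)
    (x : Fin n → Fin k → ℝ)
    (hx01 : ∀ t l, x t l = 0 ∨ x t l = 1)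
    (hx1 : ∀ t, ∑ l, x t l ≤ 1)
    (v : Fin m → ℝ)
    (hv : ∀ j, v j = ψ j * Real.sqrt (∑ t, x t ⬝ᵥ (K t j).mulVec (x t)) -
        ψ j / Real.sqrt n * ∑ t, γ t j ⬝ᵥ x t) :
    Real.sqrt (∑ j, v j ^ 2) ≤
      Real.sqrt m * ψbar * Real.sqrt Kbar * Real.sqrt n := by
  have hbar (j : Fin m) : ψ j ≤ ψbar := hψbar.2 ⟨j, rfl⟩
  have hψbar_nonneg : 0 ≤ ψbar := (hψ ⟨0, hm⟩).trans (hbar _)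
  have hbounds (t : Fin n) (j : Fin m) :
      x t ⬝ᵥ (K t j).mulVec (x t) ≤ Kbar ∧ 0 ≤ γ t j ⬝ᵥ x t ∧ γ t j ⬝ᵥ x t ≤ √Kbar := by
    rw [show γ t j = fun l => √(K t j l l) from funext (hγ t j)]
    exact quadratic_and_sqrt_diag_bounds hKbar (hKdiag t j) (hx01 t) (hx1 t)
  have hsqrt_pos : 0 < √(n : ℝ) := Real.sqrt_pos.2 (by exact_mod_cast hn)
  have hv_abs (j : Fin m) : |v j| ≤ ψbar * (√Kbar * √n) := by
    have hcone : √(∑ t, x t ⬝ᵥ (K t j).mulVec (x t)) ≤ √Kbar * √n := by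
      rw [← Real.sqrt_mul hKbar]
      refine Real.sqrt_le_sqrt ((Finset.sum_le_sum fun t _ => (hbounds t j).1).trans_eq ?_)
      simp [mul_comm]
    have hlin_nonneg : 0 ≤ (∑ t, γ t j ⬝ᵥ x t) / √n :=
      div_nonneg (Finset.sum_nonneg fun t _ => (hbounds t j).2.1) hsqrt_pos.le
    have hlin : (∑ t, γ t j ⬝ᵥ x t) / √n ≤ √Kbar * √n := by
      rw [div_le_iff₀ hsqrt_pos, mul_assoc, Real.mul_self_sqrt n.cast_nonneg]
      refine (Finset.sum_le_sum fun t _ => (hbounds t j).2.2).trans_eq ?_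
      simp [mul_comm]
    rw [hv j, div_mul_eq_mul_div, mul_div_assoc, ← mul_sub, abs_mul, abs_of_nonneg (hψ j)]
    refine mul_le_mul (hbar j) ?_ (abs_nonneg _) hψbar_nonneg
    exact abs_sub_le_of_nonneg_of_le (Real.sqrt_nonneg _) hcone hlin_nonneg hlin
  have hrhs : √m * ψbar * √Kbar * √n = √(m * (ψbar * (√Kbar * √n)) ^ 2) := by
    rw [Real.sqrt_mul m.cast_nonneg, Real.sqrt_sq (by positivity)]
    ring
  rw [hrhs]
  refine Real.sqrt_le_sqrt ((Finset.sum_le_sum fun j _ => ?_).trans_eq (?_ :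
    ∑ _j : Fin m, (ψbar * (√Kbar * √n)) ^ 2 = _))
  · exact sq_le_sq' (abs_le.1 (hv_abs j)).1 (abs_le.1 (hv_abs j)).2
  · simp
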